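/- arXiv:1901.01564 — 6 statements merged into one kernel-verified Lean document; each statement's English description precedes it below -/
import Mathlib

section
/- Let φ : X* → K_5 be the monoid homomorphism from the free monoid over a countably infinite alphabet X extending the map sending the letter x to h_1h_2h_3 and the letter y to h_4. Then (x²yx)φ ≠ (xyx²)φ in the Kauffman monoid K_5. -/
/-- The generators of the Kauffman monoid `K_n`: `none` is the generator `c`, and
`some i` (for `i : Fin (n-1)`) is the generator `h_{i+1}`. -/
abbrev KGen (n : ℕ) : Type := Option (Fin (n - 1))

/-- The generator `c` of `K_n`, as an element of the free monoid. -/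
def cgen (n : ℕ) : FreeMonoid (KGen n) := FreeMonoid.of none

/-- The generator `h_{i+1}` of `K_n` (for `i : Fin (n-1)`), as an element of the free
monoid. -/
def hgen (n : ℕ) (i : Fin (n - 1)) : FreeMonoid (KGen n) := FreeMonoid.of (some i)

/-- The defining relations of the Kauffman monoid `K_n`: writing `hᵢ := hgen n i`
(which represents `h_{i+1}`), they are `hᵢhⱼ = hⱼhᵢ` for `|i-j| ≥ 2`,
`hᵢhⱼhᵢ = hᵢ` for `|i-j| = 1`, and `hᵢ² = chᵢ = hᵢc` for all `i`. -/
inductive KRel (n : ℕ) : FreeMonoid (KGen n) → FreeMonoid (KGen n) → Prop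
  | comm (i j : Fin (n - 1)) (h : (i : ℕ) + 2 ≤ j ∨ (j : ℕ) + 2 ≤ i) :
      KRel n (hgen n i * hgen n j) (hgen n j * hgen n i)
  | braid (i j : Fin (n - 1)) (h : (i : ℕ) + 1 = j ∨ (j : ℕ) + 1 = i) :
      KRel n (hgen n i * hgen n j * hgen n i) (hgen n i)
  | sq (i : Fin (n - 1)) : KRel n (hgen n i * hgen n i) (cgen n * hgen n i)
  | commc (i : Fin (n - 1)) : KRel n (cgen n * hgen n i) (hgen n i * cgen n)

/-- The congruence generated by the defining relations of `K_n`. -/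
def KCon (n : ℕ) : Con (FreeMonoid (KGen n)) := conGen (KRel n)

/-- The Kauffman monoid `K_n`. -/
def K (n : ℕ) : Type := (KCon n).Quotient

instance (n : ℕ) : Monoid (K n) := Con.monoid (KCon n)

/-- The generator `c` of the Kauffman monoid `K_n`. -/
def K.c (n : ℕ) : K n := (KCon n).mk' (cgen n)

/-- The generator `h_{i+1}` of the Kauffman monoid `K_n`, for `i : Fin (n-1)`. -/
def K.h (n : ℕ) (i : Fin (n - 1)) : K n := (KCon n).mk' (hgen n i)

/-- The action of `h_{i+1}` on the five half-diagrams on five points with one defect,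
together with an absorbing zero (loops are sent to zero). -/
def hAct : Fin 4 → Function.End (Fin 6) :=
  ![![0, 0, 0, 2, 1, 1], ![0, 4, 3, 0, 0, 3], ![0, 0, 1, 5, 1, 0], ![0, 2, 0, 0, 3, 3]]

/-- The action of all generators; `c` acts as zero. -/
def genAct : KGen 5 → Function.End (Fin 6)
  | none => fun _ => 0
  | some i => hAct i

set_option synthInstance.maxHeartbeats 400000 in
set_option synthInstance.maxSize 4000 in
theorem genAct_rel : KCon 5 ≤ Con.ker (FreeMonoid.lift genAct) := by
  refine Con.conGen_le.2 ?_
  intro a b hab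
  rw [Con.ker_rel]
  cases hab with
  | comm i j h =>
    simp only [hgen, map_mul, FreeMonoid.lift_eval_of, genAct]
    have key : ∀ i j : Fin 4, ((i : ℕ) + 2 ≤ j ∨ (j : ℕ) + 2 ≤ i) →
        ∀ t, hAct i (hAct j t) = hAct j (hAct i t) := by decide
    exact funext (key i j h)
  | braid i j h =>
    simp only [hgen, map_mul, FreeMonoid.lift_eval_of, genAct]
    have key : ∀ i j : Fin 4, ((i : ℕ) + 1 = j ∨ (j : ℕ) + 1 = i) →
        ∀ t : Fin 6, (show Fin 6 from hAct i (hAct j (hAct i t))) = (show Fin 6 from hAct i t) := by decide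
    exact funext (key i j h)
  | sq i =>
    simp only [hgen, cgen, map_mul, FreeMonoid.lift_eval_of, genAct]
    have key : ∀ i : Fin 4, ∀ t, hAct i (hAct i t) = 0 := by decide
    exact funext (key i)
  | commc i =>
    simp only [hgen, cgen, map_mul, FreeMonoid.lift_eval_of, genAct]
    have key : ∀ i : Fin 4, (0 : Fin 6) = hAct i 0 := by decide
    exact funext fun _ => key i

/-- The induced representation of `K_5`. -/
def kAct : K 5 →* Function.End (Fin 6) := Con.lift (KCon 5) (FreeMonoid.lift genAct) genAct_rel

theorem kAct_h (i : Fin 4) : kAct (K.h 5 i) = hAct i := rfl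

/-- **Proposition 5.** If a monoid homomorphism `φ` from the free monoid over the
countably infinite alphabet `ℕ` to the Kauffman monoid `K₅` sends the letter `x` to
`h₁h₂h₃` and the letter `y` to `h₄` (where `x ≠ y`), then `(x²yx)φ ≠ (xyx²)φ`. -/
theorem K5_x2yx_ne_xyx2 (x y : ℕ) (hxy : x ≠ y) (φ : FreeMonoid ℕ →* K 5)
    (hx : φ (FreeMonoid.of x) = K.h 5 0 * K.h 5 1 * K.h 5 2)
    (hy : φ (FreeMonoid.of y) = K.h 5 3) :
    φ (FreeMonoid.ofList [x, x, y, x]) ≠ φ (FreeMonoid.ofList [x, y, x, x]) := by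
  intro h
  have e1 : FreeMonoid.ofList [x, x, y, x] = FreeMonoid.of x * FreeMonoid.of x *
      FreeMonoid.of y * FreeMonoid.of x := rfl
  have e2 : FreeMonoid.ofList [x, y, x, x] = FreeMonoid.of x * FreeMonoid.of y *
      FreeMonoid.of x * FreeMonoid.of x := rfl
  rw [e1, e2] at h
  simp only [map_mul, hx, hy] at h
  have h2 := congrArg kAct h
  simp only [map_mul] at h2
  have h3 := congrFun h2 (3 : Fin 6)
  revert h3
  change ¬ (hAct 0 (hAct 1 (hAct 2 (hAct 0 (hAct 1 (hAct 2 (hAct 3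
    (hAct 0 (hAct 1 (hAct 2 3))))))))) = hAct 0 (hAct 1 (hAct 2 (hAct 3
    (hAct 0 (hAct 1 (hAct 2 (hAct 0 (hAct 1 (hAct 2 3))))))))))
  decide
end

section
/- The identity x²yx ≍ xyx² (where x and y are distinct letters) does not hold in the Kauffman monoid K_5. -/
/-- The identity `w ≍ w'` (words over the countably infinite alphabet `ℕ`) holds in the
monoid `M` if every monoid homomorphism from the free monoid over `ℕ` to `M` equalizes
`w` and `w'`. -/
def HoldsIn (M : Type*) [Monoid M] (w w' : List ℕ) : Prop :=
  ∀ φ : FreeMonoid ℕ →* M, φ (FreeMonoid.ofList w) = φ (FreeMonoid.ofList w')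

/-- Matrices of the generators on the 5-dimensional cell module of the Temperley–Lieb
algebra on 5 strands with loop parameter 2. -/
def repGen : Option (Fin 4) → Matrix (Fin 5) (Fin 5) ℤ
  | none => !![2,0,0,0,0; 0,2,0,0,0; 0,0,2,0,0; 0,0,0,2,0; 0,0,0,0,2]
  | some 0 => !![2,0,1,0,1; 0,2,0,1,0; 0,0,0,0,0; 0,0,0,0,0; 0,0,0,0,0]
  | some 1 => !![0,0,0,0,0; 0,0,0,0,0; 1,0,2,0,0; 0,1,0,2,1; 0,0,0,0,0]
  | some 2 => !![2,1,1,0,0; 0,0,0,0,0; 0,0,0,0,0; 0,0,0,0,0; 0,0,0,1,2]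
  | some 3 => !![0,0,0,0,0; 1,2,0,0,0; 0,0,0,0,0; 0,0,1,2,1; 0,0,0,0,0]

theorem repGen_comm : ∀ i j : Fin 4, ((i : ℕ) + 2 ≤ j ∨ (j : ℕ) + 2 ≤ i) →
    repGen (some i) * repGen (some j) = repGen (some j) * repGen (some i) := by
  decide +kernel

theorem repGen_braid : ∀ i j : Fin 4, ((i : ℕ) + 1 = j ∨ (j : ℕ) + 1 = i) →
    repGen (some i) * repGen (some j) * repGen (some i) = repGen (some i) := by
  decide +kernel

theorem repGen_sq : ∀ i : Fin 4,
    repGen (some i) * repGen (some i) = repGen none * repGen (some i) := by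
  decide +kernel

theorem repGen_commc : ∀ i : Fin 4,
    repGen none * repGen (some i) = repGen (some i) * repGen none := by
  decide +kernel

/-- The induced homomorphism on the free monoid. -/
def repFree : FreeMonoid (KGen 5) →* Matrix (Fin 5) (Fin 5) ℤ := FreeMonoid.lift repGen

theorem repFree_le : KCon 5 ≤ Con.ker repFree := by
  refine Con.conGen_le.2 ?_
  intro a b h
  change repFree a = repFree b
  cases h with
  | comm i j h => simpa [repFree, hgen] using repGen_comm i j h
  | braid i j h => simpa [repFree, hgen] using repGen_braid i j h
  | sq i => simpa [repFree, hgen, cgen] using repGen_sq i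
  | commc i => simpa [repFree, hgen, cgen] using repGen_commc i

theorem repGen_ne :
    let X := repGen (some 0) * repGen (some 1) * repGen (some 2)
    X * (X * (repGen (some 3) * X)) ≠ X * (repGen (some 3) * (X * X)) := by
  decide +kernel

/-- The identity `x²yx ≍ xyx²` (with `x` and `y` distinct letters) does not hold in the
Kauffman monoid `K₅`. -/
theorem K5_not_holdsIn_x2yx_xyx2 (x y : ℕ) (hxy : x ≠ y) :
    ¬ HoldsIn (K 5) [x, x, y, x] [x, y, x, x] := by
  intro H
  let X : FreeMonoid (KGen 5) := hgen 5 0 * hgen 5 1 * hgen 5 2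
  let f : ℕ → FreeMonoid (KGen 5) := fun z => if z = x then X else hgen 5 3
  have h := H ((KCon 5).mk'.comp (FreeMonoid.lift f))
  have h2 : KCon 5 (FreeMonoid.lift f (FreeMonoid.ofList [x, x, y, x]))
      (FreeMonoid.lift f (FreeMonoid.ofList [x, y, x, x])) := (Con.eq _).1 h
  have h3 : repFree _ = repFree _ := repFree_le h2
  have hx : f x = X := if_pos rfl
  have hy : f y = hgen 5 3 := if_neg (Ne.symm hxy)
  apply repGen_ne
  simpa [FreeMonoid.lift_apply, hx, hy, X, repFree, hgen, mul_assoc] using h3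
end

section
/- In the Kauffman monoid K_5, the equalities (h_1h_2h_3)²h_4h_1h_2h_3 = c·h_1h_3h_2h_4h_3 and h_1h_2h_3h_4(h_1h_2h_3)² = h_1h_3 hold, and the elements c·h_1h_3h_2h_4h_3 and h_1h_3 of K_5 are distinct. -/
/-- Action of the generators of `K₅` on the five one-defect link states (`1,…,5`) together
with a zero state `0`; a closed loop gives zero. -/
def actTable : KGen 5 → Fin 6 → Fin 6
  | none => ![0, 0, 0, 0, 0, 0]
  | some i => (![![0, 0, 0, 2, 1, 1], ![0, 4, 3, 0, 0, 3], ![0, 0, 1, 5, 1, 0],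
      ![0, 2, 0, 0, 3, 3]] : Fin 4 → Fin 6 → Fin 6) i

/-- The action as a homomorphism from the free monoid. -/
def actFree : FreeMonoid (KGen 5) →* Function.End (Fin 6) :=
  FreeMonoid.lift (fun g => (actTable g : Function.End (Fin 6)))

theorem actFree_c (x : Fin 6) : actFree (cgen 5) x = actTable none x := rfl

theorem actFree_h (i : Fin 4) (x : Fin 6) : actFree (hgen 5 i) x = actTable (some i) x := rfl

theorem end_mul_apply (f g : Function.End (Fin 6)) (x : Fin 6) : (f * g) x = f (g x) := rfl

theorem KCon_le_ker : KCon 5 ≤ Con.ker actFree := by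
  refine Con.conGen_le.2 ?_
  intro x y h
  rw [Con.ker_rel]
  funext z
  cases h with
  | comm i j h =>
    simp only [map_mul, end_mul_apply, actFree_h]
    revert i j z; decide
  | braid i j h =>
    simp only [map_mul, end_mul_apply, actFree_h]
    revert i j z; decide
  | sq i =>
    simp only [map_mul, end_mul_apply, actFree_h, actFree_c]
    revert i z; decide
  | commc i =>
    simp only [map_mul, end_mul_apply, actFree_h, actFree_c]
    revert i z; decide

theorem K_of_rel {x y : FreeMonoid (KGen 5)} (h : KRel 5 x y) :
    (KCon 5).mk' x = (KCon 5).mk' y :=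
  (Con.eq (KCon 5)).2 (ConGen.Rel.of _ _ h)

theorem K_comm (i j : Fin 4) (h : (i : ℕ) + 2 ≤ j ∨ (j : ℕ) + 2 ≤ i) :
    K.h 5 i * K.h 5 j = K.h 5 j * K.h 5 i :=
  K_of_rel (KRel.comm (n := 5) i j h)

theorem K_braid (i j : Fin 4) (h : (i : ℕ) + 1 = j ∨ (j : ℕ) + 1 = i) :
    K.h 5 i * K.h 5 j * K.h 5 i = K.h 5 i :=
  K_of_rel (KRel.braid (n := 5) i j h)

theorem K_sq (i : Fin 4) : K.h 5 i * K.h 5 i = K.c 5 * K.h 5 i :=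
  K_of_rel (KRel.sq (n := 5) i)

theorem word_eqs {M : Type*} [Monoid M] (c a b d e : M) (had : a * d = d * a)
    (hae : a * e = e * a) (hbe : b * e = e * b) (haba : a * b * a = a)
    (hdbd : d * b * d = d) (hded : d * e * d = d) (haa : a * a = c * a) :
    (a * b * d) ^ 2 * e * (a * b * d) = c * (a * d * b * e * d) ∧
      a * b * d * e * (a * b * d) ^ 2 = a * d := by
  have h2 : (a * b * d) ^ 2 = a * d := by
    calc (a * b * d) ^ 2 = a * b * (d * a) * b * d := by simp only [pow_two, mul_assoc]
      _ = (a * b * a) * (d * b * d) := by rw [← had]; simp only [mul_assoc]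
      _ = a * d := by rw [haba, hdbd]
  rw [h2]
  constructor
  · calc a * d * e * (a * b * d) = a * d * (e * a) * b * d := by simp only [mul_assoc]
      _ = a * (d * a) * e * b * d := by rw [← hae]; simp only [mul_assoc]
      _ = (a * a) * d * (e * b) * d := by rw [← had]; simp only [mul_assoc]
      _ = c * (a * d * b * e * d) := by rw [haa, ← hbe]; simp only [mul_assoc]
  · calc a * b * d * e * (a * d) = a * b * d * (e * a) * d := by simp only [mul_assoc]
      _ = a * b * (d * a) * e * d := by rw [← hae]; simp only [mul_assoc]
      _ = (a * b * a) * (d * e * d) := by rw [← had]; simp only [mul_assoc]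
      _ = a * d := by rw [haba, hded]

/-- In the Kauffman monoid `K₅` (with `h₁ = K.h 5 0`, `h₂ = K.h 5 1`, `h₃ = K.h 5 2`,
`h₄ = K.h 5 3`, `c = K.c 5`), the equalities
`(h₁h₂h₃)²h₄h₁h₂h₃ = c·h₁h₃h₂h₄h₃` and `h₁h₂h₃h₄(h₁h₂h₃)² = h₁h₃` hold, and the
elements `c·h₁h₃h₂h₄h₃` and `h₁h₃` of `K₅` are distinct. -/
theorem K5_proposition :
    (K.h 5 0 * K.h 5 1 * K.h 5 2) ^ 2 * K.h 5 3 * (K.h 5 0 * K.h 5 1 * K.h 5 2) =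
        K.c 5 * (K.h 5 0 * K.h 5 2 * K.h 5 1 * K.h 5 3 * K.h 5 2) ∧
      K.h 5 0 * K.h 5 1 * K.h 5 2 * K.h 5 3 * (K.h 5 0 * K.h 5 1 * K.h 5 2) ^ 2 =
        K.h 5 0 * K.h 5 2 ∧
      K.c 5 * (K.h 5 0 * K.h 5 2 * K.h 5 1 * K.h 5 3 * K.h 5 2) ≠ K.h 5 0 * K.h 5 2 := by
  have hw := word_eqs (K.c 5) (K.h 5 0) (K.h 5 1) (K.h 5 2) (K.h 5 3)
    (K_comm 0 2 (by decide)) (K_comm 0 3 (by decide)) (K_comm 1 3 (by decide))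
    (K_braid 0 1 (by decide)) (K_braid 2 1 (by decide)) (K_braid 2 3 (by decide)) (K_sq 0)
  refine ⟨hw.1, hw.2, fun h => ?_⟩
  have h1 : KCon 5 (cgen 5 * (hgen 5 0 * hgen 5 2 * hgen 5 1 * hgen 5 3 * hgen 5 2))
      (hgen 5 0 * hgen 5 2) := (Con.eq (KCon 5)).1 h
  have h2 := KCon_le_ker h1
  rw [Con.ker_rel] at h2
  have h3 := congrFun h2 3
  simp only [map_mul, end_mul_apply, actFree_c] at h3
  erw [actFree_h, actFree_h, actFree_h, actFree_h, actFree_h, actFree_h] at h3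
  revert h3
  decide
end

section
/- Let w be a nonempty word over an alphabet X, let v be the first occurrence word of w, and let G ⊆ X be a set of letters with al(w) ⊄ G (so that w_G is nonempty). Then v_G is the first occurrence word of w_G. -/
open scoped Classical

/-- The content `al(w)` of a word: the set of letters occurring in it. -/
def content {α : Type*} (w : List α) : Set α := {x | x ∈ w}

/-- `remove G w` is the word `w_G` obtained from `w` by removing all occurrences of
the letters in `G`. -/
noncomputable def remove {α : Type*} (G : Set α) (w : List α) : List α :=
  w.filter fun a => decide (a ∉ G)

/-- The first occurrence word of `w`: retain only the first occurrence of each letter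
occurring in `w`. -/
def firstOccWord {α : Type*} [DecidableEq α] (w : List α) : List α :=
  w.reverse.dedup.reverse

theorem filter_dedup_aux {α : Type*} [DecidableEq α] (p : α → Bool) (l : List α) :
    l.dedup.filter p = (l.filter p).dedup := by
  induction l with
  | nil => simp
  | cons a l ih =>
    by_cases h : a ∈ l
    · rw [List.dedup_cons_of_mem h, ih]
      by_cases hp : p a = true
      · rw [List.filter_cons_of_pos hp, List.dedup_cons_of_mem (List.mem_filter.2 ⟨h, hp⟩)]
      · rw [List.filter_cons_of_neg hp]
    · rw [List.dedup_cons_of_notMem h]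
      by_cases hp : p a = true
      · rw [List.filter_cons_of_pos hp, List.filter_cons_of_pos hp, ih,
          List.dedup_cons_of_notMem (fun h' => h (List.mem_filter.1 h').1)]
      · rw [List.filter_cons_of_neg hp, List.filter_cons_of_neg hp, ih]

/-- Let `w` be a nonempty word over an alphabet `X`, let `v` be the first occurrence
word of `w`, and let `G ⊆ X` be a set of letters with `al(w) ⊄ G` (so that `w_G` is
nonempty). Then `v_G` is the first occurrence word of `w_G`. -/
theorem remove_firstOccWord {α : Type*} [DecidableEq α] (w : List α) (hw : w ≠ [])
    (G : Set α) (hG : ¬ content w ⊆ G) :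
    remove G (firstOccWord w) = firstOccWord (remove G w) := by
  unfold remove firstOccWord
  rw [List.filter_reverse, filter_dedup_aux, List.filter_reverse]
end

section
/- Let w be a nonempty word over an alphabet X, let v be the last occurrence word of w, and let G ⊆ X be a set of letters with al(w) ⊄ G (so that w_G is nonempty). Then v_G is the last occurrence word of w_G. -/
open scoped Classical

/-- The last occurrence word of `w`: retain only the last occurrence of each letter
occurring in `w`. -/
def lastOccWord {α : Type*} [DecidableEq α] (w : List α) : List α :=
  w.dedup

/-- Let `w` be a nonempty word over an alphabet `X`, let `v` be the last occurrence
word of `w`, and let `G ⊆ X` be a set of letters with `al(w) ⊄ G` (so that `w_G` is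
nonempty). Then `v_G` is the last occurrence word of `w_G`. -/
theorem remove_lastOccWord {α : Type*} [DecidableEq α] (w : List α) (hw : w ≠ [])
    (G : Set α) (hG : ¬ content w ⊆ G) :
    remove G (lastOccWord w) = lastOccWord (remove G w) := by
  clear hw hG
  unfold remove lastOccWord
  induction w with
  | nil => simp
  | cons a l ih =>
    by_cases hG : a ∈ G <;> by_cases hl : a ∈ l
    · rw [List.dedup_cons_of_mem hl, ih, List.filter_cons_of_neg (by simpa using hG)]
    · rw [List.dedup_cons_of_notMem hl, List.filter_cons_of_neg (by simpa using hG), ih,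
        List.filter_cons_of_neg (by simpa using hG)]
    · rw [List.dedup_cons_of_mem hl, ih, List.filter_cons_of_pos (by simpa using hG),
        List.dedup_cons_of_mem (by simp [hl, hG])]
    · rw [List.dedup_cons_of_notMem hl, List.filter_cons_of_pos (by simpa using hG), ih,
        List.filter_cons_of_pos (by simpa using hG), List.dedup_cons_of_notMem (by simp [hl])]
end

section
/- For each n ≥ 2, every element of the Kauffman monoid K_n is represented by a unique word in Jones's normal form over the alphabet {c, h_1, …, h_{n-1}}: that is, the map sending each word in Jones's normal form to the element of K_n it represents is a bijection onto K_n. -/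
/-- `hInterval n a b` is the word `h_{[b+1, a+1]} = h_{b+1} h_b ⋯ h_{a+2} h_{a+1}`
(recall that the index `i : Fin (n-1)` encodes the generator `h_{i+1}`); it is the
descending product of the generators `h` with indices from `b` down to `a`. -/
def hInterval (n : ℕ) (a b : Fin (n - 1)) : FreeMonoid (KGen n) :=
  ((List.range (b.val + 1 - a.val)).map fun t =>
    FreeMonoid.of (some
      (⟨b.val - t, Nat.lt_of_le_of_lt (Nat.sub_le _ _) b.isLt⟩ : Fin (n - 1)))).prod

/-- A word over the alphabet `{c, h₁, …, h_{n-1}}` is in Jones's normal form if it is of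
the form `c^l h_{[b₁,a₁]} ⋯ h_{[b_k,a_k]}` with `a₁ < ⋯ < a_k`, `b₁ < ⋯ < b_k` and
`aᵢ ≤ bᵢ` for all `i` (the case `k = 0` being the form `c^l`). -/
def IsJonesNF (n : ℕ) (w : FreeMonoid (KGen n)) : Prop :=
  ∃ (l k : ℕ) (a b : Fin k → Fin (n - 1)),
    StrictMono a ∧ StrictMono b ∧ (∀ i, a i ≤ b i) ∧
      w = cgen n ^ l * (List.ofFn fun i => hInterval n (a i) (b i)).prod

def KOp {P : Type} [DecidableEq P] (σ : P → P) (p q : P) (x : P) : P :=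
  if x = p then q else if x = q then p else if x = σ p then σ q else if x = σ q then σ p else σ x

/-- Number of loops created when the connection between `p` and `q` is closed. -/
def KLoop {P : Type} [DecidableEq P] (σ : P → P) (p q : P) : ℕ := if σ p = q then 1 else 0

def KMatch {P : Type} (σ : P → P) : Prop := (∀ x, σ (σ x) = x) ∧ ∀ x, σ x ≠ x

section
variable {P : Type} [DecidableEq P] {σ : P → P}

theorem KOp_match (hσ : KMatch σ) {p q : P} (h : p ≠ q) : KMatch (KOp σ p q) := by
  obtain ⟨h1, h2⟩ := hσ
  constructor
  · intro x; unfold KOp; grind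
  · intro x; unfold KOp; grind

theorem KOp_sq (hσ : KMatch σ) {p q : P} (h : p ≠ q) : KOp (KOp σ p q) p q = KOp σ p q := by
  obtain ⟨h1, h2⟩ := hσ
  funext x; unfold KOp; grind

theorem KOp_symm (hσ : KMatch σ) {p q : P} (h : p ≠ q) : KOp σ p q = KOp σ q p := by
  obtain ⟨h1, h2⟩ := hσ
  funext x; unfold KOp; grind

theorem KOp_braid (hσ : KMatch σ) {p q r : P} (h : p ≠ q) (h' : q ≠ r) (h'' : p ≠ r) :
    KOp (KOp (KOp σ p q) q r) p q = KOp σ p q := by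
  obtain ⟨h1, h2⟩ := hσ
  funext x; unfold KOp; grind

theorem KOp_braid_count (hσ : KMatch σ) {p q r : P} (h : p ≠ q) (h' : q ≠ r) (h'' : p ≠ r) :
    KOp σ p q q ≠ r ∧ KOp (KOp σ p q) q r p ≠ q := by
  obtain ⟨h1, h2⟩ := hσ
  unfold KOp; grind

theorem KOp_comm (hσ : KMatch σ) {p q r s : P} (h : p ≠ q) (h' : r ≠ s) (h1 : p ≠ r) (h2 : p ≠ s)
    (h3 : q ≠ r) (h4 : q ≠ s) :
    KOp (KOp σ p q) r s = KOp (KOp σ r s) p q := by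
  obtain ⟨h1, h2⟩ := hσ
  funext x; unfold KOp; grind (splits := 30)

theorem KOp_comm_count (hσ : KMatch σ) {p q r s : P} (h : p ≠ q) (_h' : r ≠ s) (h1 : p ≠ r)
    (h2 : p ≠ s) (h3 : q ≠ r) (h4 : q ≠ s) :
    KLoop σ p q + KLoop (KOp σ p q) r s = KLoop σ r s + KLoop (KOp σ r s) p q := by
  obtain ⟨h1, h2⟩ := hσ
  unfold KLoop KOp; grind (splits := 30)
end
section
variable {M : Type} [Monoid M] (h : ℕ → M)

def KD (a : ℕ) : ℕ → M
  | 0 => 1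
  | d + 1 => h (a + d) * KD a d

theorem KD_add (a d e : ℕ) : KD h a (d + e) = KD h (a + d) e * KD h a d := by
  induction e with
  | zero => simp [KD]
  | succ e ih => rw [← add_assoc, KD, ih, KD, mul_assoc, add_assoc]

theorem KD_one (a : ℕ) : KD h a 1 = h a := by simp [KD]

theorem KD_succ' (a d : ℕ) : KD h a (d + 1) = KD h (a + 1) d * h a := by
  rw [add_comm d 1, KD_add, KD_one]

structure KHyp (r : ℕ) (c : M) (h : ℕ → M) : Prop where
  comm : ∀ i j, i + 2 ≤ j → j < r → h i * h j = h j * h i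
  braid1 : ∀ i, i + 1 < r → h i * h (i + 1) * h i = h i
  braid2 : ∀ i, i + 1 < r → h (i + 1) * h i * h (i + 1) = h (i + 1)
  sq : ∀ i, i < r → h i * h i = c * h i
  cen : ∀ x, c * x = x * c

inductive KW (c : M) (h : ℕ → M) (m : ℕ) : ℕ → M → Prop
  | base (N l : ℕ) : KW c h m N (c ^ l)
  | step (N : ℕ) (x : M) (j : ℕ) : KW c h m N x → j < m → KW c h m (N + 1) (x * h j)

inductive KNF (c : M) (h : ℕ → M) : ℕ → ℕ → ℕ → M → Prop
  | base (p q N l : ℕ) : KNF c h p q N (c ^ l)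
  | step (p q N N' a d : ℕ) (x : M) : KNF c h (a + d) a N x → a + d < p → a < q →
      N + (d + 1) ≤ N' → KNF c h p q N' (x * KD h a (d + 1))

variable {h} {c : M} {r : ℕ}

theorem KW.mono {m N : ℕ} {x : M} (hx : KW c h m N x) : ∀ {N'}, N ≤ N' → KW c h m N' x := by
  induction hx with
  | base N l => intro N' _; exact KW.base _ _
  | step N x j hx hj ih =>
    intro N' hN
    obtain ⟨k, rfl⟩ : ∃ k, N' = k + 1 := ⟨N' - 1, by omega⟩
    exact KW.step _ _ _ (ih (by omega)) hj

theorem KW.monom {m N : ℕ} {x : M} (hx : KW c h m N x) : ∀ {m'}, m ≤ m' → KW c h m' N x := by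
  induction hx with
  | base N l => intro N' _; exact KW.base _ _
  | step N x j hx hj ih =>
    intro m' hm
    exact KW.step _ _ _ (ih (by omega)) (by omega)

theorem KW.cmul {m N : ℕ} {x : M} (hx : KW c h m N x) : KW c h m N (c * x) := by
  induction hx with
  | base N l => rw [← pow_succ']; exact KW.base _ _
  | step N x j hx hj ih => rw [← mul_assoc]; exact KW.step _ _ _ ih hj

theorem KW.mulD {m N : ℕ} {x : M} (hx : KW c h m N x) (a d : ℕ) (had : a + d ≤ m) :
    KW c h m (N + d) (x * KD h a d) := by
  induction d generalizing N x a with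
  | zero => simpa [KD] using hx
  | succ d ih =>
    rw [KD, ← mul_assoc]
    have := ih (KW.step _ _ _ hx (show a + d < m by omega)) a (by omega)
    rwa [show N + (d + 1) = N + 1 + d by omega]

theorem KNF.toW {p q N : ℕ} {x : M} (hx : KNF c h p q N x) : ∀ {m}, p ≤ m → KW c h m N x := by
  induction hx with
  | base => intro m _; exact KW.base _ _
  | step p q N N' a d x hx h1 h2 h3 ih =>
    intro m hm
    exact ((ih (by omega)).mulD a (d + 1) (by omega)).mono h3

theorem KNF.mono {p q N p' q' N' : ℕ} {x : M} (hx : KNF c h p q N x) (hp : p ≤ p') (hq : q ≤ q')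
    (hN : N ≤ N') : KNF c h p' q' N' x := by
  cases hx with
  | base => exact KNF.base _ _ _ _
  | step _ _ N0 _ a d x hx h1 h2 h3 =>
    exact KNF.step _ _ N0 _ a d x hx (by omega) (by omega) (by omega)

theorem KHyp.hD_low (H : KHyp r c h) (j a d : ℕ) (h1 : j + 2 ≤ a) (h2 : a + d ≤ r) :
    KD h a d * h j = h j * KD h a d := by
  induction d with
  | zero => simp [KD]
  | succ d ih =>
    rw [KD, mul_assoc, ih (by omega), ← mul_assoc, ← mul_assoc, H.comm j (a + d) (by omega) (by omega)]

theorem KHyp.hD_high (H : KHyp r c h) (j a d : ℕ) (h1 : a + d < j) (h2 : j < r) :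
    KD h a d * h j = h j * KD h a d := by
  induction d with
  | zero => simp [KD]
  | succ d ih =>
    rw [KD, mul_assoc, ih (by omega), ← mul_assoc, ← mul_assoc, H.comm (a + d) j (by omega) (by omega)]

theorem KHyp.DD (H : KHyp r c h) (a d b e : ℕ) (h1 : a + d < b) (h2 : b + e ≤ r) :
    KD h a d * KD h b e = KD h b e * KD h a d := by
  induction e with
  | zero => simp [KD]
  | succ e ih =>
    rw [KD, ← mul_assoc, H.hD_high (b + e) a d (by omega) (by omega), mul_assoc, ih (by omega),
      mul_assoc]

/-- `h_[b,a] h_j` with `a < j ≤ b`. -/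
theorem KHyp.Dh (H : KHyp r c h) (a f e : ℕ) (h2 : a + f + 2 + e ≤ r) :
    KD h a (f + 2 + e) * h (a + f + 1) = KD h a f * KD h (a + f + 1) (e + 1) := by
  have h1 := H.hD_high (a + f + 1) a f (by omega) (by omega)
  have h3 := H.braid2 (a + f) (by omega)
  rw [H.DD _ _ _ _ (by omega) (by omega), KD_add, KD_succ' h (a + f + 1) e, KD, KD]
  calc _ = KD h (a + f + 2) e * (h (a + f + 1) * h (a + f)) * (KD h a f * h (a + f + 1)) := by
        simp only [mul_assoc, add_assoc]
    _ = KD h (a + f + 2) e * (h (a + f + 1) * h (a + f) * h (a + f + 1)) * KD h a f := by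
        rw [h1]; simp only [mul_assoc]
    _ = _ := by rw [h3]

theorem KHyp.red (H : KHyp r c h) (a' f d e : ℕ) (h2 : a' + f + 2 + e ≤ r) :
    KD h (a' + f) (d + 1) * KD h a' (f + 2 + e) =
      KD h (a' + f + 1) d * KD h (a' + f + 2) e * KD h a' (f + 1) := by
  rw [KD_succ', KD_add, KD, KD]
  have h1 := H.hD_low (a' + f) (a' + (f + 2)) e (by omega) (by omega)
  have h3 := H.braid1 (a' + f) (by omega)
  calc _ = KD h (a' + f + 1) d * (h (a' + f) * KD h (a' + (f + 2)) e) *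
        (h (a' + f + 1) * h (a' + f)) * KD h a' f := by simp only [mul_assoc, add_assoc]
    _ = KD h (a' + f + 1) d * KD h (a' + (f + 2)) e *
        (h (a' + f) * h (a' + f + 1) * h (a' + f)) * KD h a' f := by
        rw [← h1]; simp only [mul_assoc]
    _ = _ := by rw [h3, mul_assoc]; rfl

theorem KHyp.split (H : KHyp r c h) {m N : ℕ} (hm : m < r) {x : M} (hx : KW c h (m + 1) N x) :
    KW c h m N x ∨ ∃ a d y L, a + d = m ∧ KW c h m L y ∧ L + d + 1 ≤ N ∧
      x = y * KD h a (d + 1) := by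
  induction hx with
  | base N l => exact Or.inl (KW.base _ _)
  | step N x j hx hj ih =>
    rcases ih with ih | ⟨a, d, y, L, had, hy, hL, rfl⟩
    · by_cases hjm : j = m
      · subst hjm
        exact Or.inr ⟨j, 0, x, N, rfl, ih, by omega, by rw [KD_one]⟩
      · exact Or.inl (KW.step _ _ _ ih (by omega))
    · right
      rcases lt_trichotomy j a with hja | rfl | hja
      · by_cases hj1 : j + 1 = a
        · subst hj1
          exact ⟨j, d + 1, y, L, by omega, hy, by omega, by rw [KD_succ' h j (d + 1), mul_assoc]⟩
        · exact ⟨a, d, y * h j, L + 1, had, KW.step _ _ _ hy (by omega), by omega, by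
            rw [mul_assoc, H.hD_low _ _ _ (by omega) (by omega), mul_assoc]⟩
      · exact ⟨j, d, c * y, L, had, hy.cmul, by omega, by
          rw [KD_succ', mul_assoc, mul_assoc, H.sq j (by omega), H.cen y, mul_assoc, ← mul_assoc _ c,
            ← H.cen, mul_assoc]⟩
      · obtain ⟨f, rfl⟩ : ∃ f, j = a + f + 1 := ⟨j - a - 1, by omega⟩
        obtain ⟨e, rfl⟩ : ∃ e, d = f + 1 + e := ⟨d - f - 1, by omega⟩
        refine ⟨a + f + 1, e, y * KD h a f, L + f, by omega, hy.mulD _ _ (by omega), by omega, ?_⟩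
        rw [mul_assoc, mul_assoc, ← H.Dh a f e (by omega), show f + 1 + e + 1 = f + 2 + e by omega]

theorem KHyp.main (H : KHyp r c h) (N : ℕ) : ∀ m ≤ r, ∀ x, KW c h m N x → KNF c h m m N x := by
  induction N using Nat.strong_induction_on with
  | _ N IH =>
  intro m
  induction m with
  | zero =>
    intro _ x hx
    cases hx with
    | base => exact KNF.base _ _ _ _
    | step _ _ _ _ hj => omega
  | succ m ihm =>
    intro hm x hx
    rcases H.split (by omega) hx with hx | ⟨a, d, y, L, had, hy, hL, rfl⟩
    · exact (ihm (by omega) x hx).mono (by omega) (by omega) le_rfl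
    · have hy' := IH L (by omega) m (by omega) y hy
      cases hy' with
      | base _ _ _ l =>
        exact KNF.step _ _ L _ a d _ (KNF.base _ _ _ _) (by omega) (by omega) (by omega)
      | step _ _ N0 _ a1 d1 x hx1 h1 h2 h3 =>
        by_cases ha : a1 < a
        · exact KNF.step _ _ L _ a d _ (KNF.step _ _ N0 _ a1 d1 _ hx1 (by omega) ha h3)
            (by omega) (by omega) (by omega)
        · obtain ⟨f, rfl⟩ : ∃ f, a1 = a + f := ⟨a1 - a, by omega⟩
          obtain ⟨e, rfl⟩ : ∃ e, d = f + 1 + e := ⟨d - f - 1, by omega⟩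
          have key : KW c h (m + 1) (N0 + d1 + e + (f + 1)) (x * KD h (a + f) (d1 + 1) * KD h a (f + 1 + e + 1)) := by
            rw [mul_assoc, show f + 1 + e + 1 = f + 2 + e by omega, H.red a f d1 e (by omega),
              ← mul_assoc, ← mul_assoc]
            exact (((hx1.toW (by omega)).mulD _ _ (by omega)).mulD _ _ (by omega)).mulD _ _ (by omega)
          exact (IH _ (by omega) (m + 1) hm _ key).mono le_rfl le_rfl (by omega)
end

def KInv (σ : Bool × ℕ → Bool × ℕ) (A B : ℕ → Prop) : Prop :=
  (∀ i, i < (σ (false, i)).2 ↔ A i) ∧ (∀ i, (σ (true, i)).2 < i ↔ B i)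

theorem KInv.straight {σ : Bool × ℕ → Bool × ℕ} {A B : ℕ → Prop} (hσ : KMatch σ) (H : KInv σ A B)
    {a : ℕ} (hA : ∀ i ≤ a, ¬ A i) : ∀ i ≤ a, σ (false, i) = (true, i) := by
  intro i
  induction i using Nat.strong_induction_on with
  | _ i ih =>
  intro hi
  obtain ⟨h1, h2⟩ := hσ
  have h3 : ¬ i < (σ (false, i)).2 := fun h => hA i hi ((H.1 i).1 h)
  have h4 := h1 (false, i)
  have h5 := h2 (false, i)
  rcases hs : σ (false, i) with ⟨s, k⟩
  rw [hs] at h3 h4 h5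
  simp only [not_lt] at h3
  rcases h3.lt_or_eq with h | h
  · have h6 := ih k h (by omega)
    have h7 := h1 (false, k)
    rw [h6] at h7
    cases s
    · rw [h6] at h4; simp at h4
    · rw [h7] at h4; simp at h4; omega
  · subst h
    cases s
    · exact absurd rfl h5
    · rfl

theorem KInv.first {σ : Bool × ℕ → Bool × ℕ} {A B : ℕ → Prop} (hσ : KMatch σ) (H : KInv σ A B)
    {a : ℕ} (hA : ∀ i ≤ a, ¬ A i) (hB : ¬ B (a + 1)) :
    KInv (KOp σ (true, a) (true, a + 1)) (fun i => i = a ∨ A i) (fun i => i = a + 1 ∨ B i) ∧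
      σ (true, a) ≠ (true, a + 1) := by
  have hs := H.straight hσ hA a le_rfl
  have hAa := hA a le_rfl
  obtain ⟨h1, h2⟩ := hσ
  obtain ⟨H1, H2⟩ := H
  have hs' : σ (true, a) = (false, a) := by rw [← hs, h1]
  have hx := h1 (true, a + 1)
  have hx2 := h2 (true, a + 1)
  have hB' := (H2 (a + 1)).not.2 hB
  refine ⟨⟨fun i => ?_, fun i => ?_⟩, by simp [hs']⟩
  · have H1i := H1 i
    beta_reduce
    rw [← H1i]
    unfold KOp
    rw [hs']
    rcases hσx : σ (true, a + 1) with ⟨s, k⟩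
    rw [hσx] at hx hx2 hB'
    simp only at hB'
    by_cases hia : i = a
    · subst hia
      simp; omega
    · by_cases hik : ((false, i) : Bool × ℕ) = (s, k)
      · rw [hik]; cases s <;> grind
      · simp [hia, hik]
  · have H2i := H2 i
    beta_reduce
    rw [← H2i]
    unfold KOp
    rw [hs']
    rcases hσx : σ (true, a + 1) with ⟨s, k⟩
    rw [hσx] at hx hx2 hB'
    simp only at hB'
    by_cases hia : i = a
    · subst hia
      simp [hs']
    · by_cases hia' : i = a + 1
      · subst hia'; simp
      · by_cases hik : ((true, i) : Bool × ℕ) = (s, k)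
        · rw [hik]; cases s <;> grind
        · simp [hia, hik, hia']

theorem KInv.next {σ : Bool × ℕ → Bool × ℕ} {A B : ℕ → Prop} (hσ : KMatch σ)
    {j : ℕ} (H : KInv σ A (fun i => i = j + 1 ∨ B i)) (hj : σ (true, j) = (true, j + 1))
    (hB0 : ¬ B (j + 1)) (hB : ¬ B (j + 2)) :
    KInv (KOp σ (true, j + 1) (true, j + 2)) A (fun i => i = j + 2 ∨ B i) ∧
      σ (true, j + 1) ≠ (true, j + 2) := by
  obtain ⟨h1, h2⟩ := hσ
  obtain ⟨H1, H2⟩ := H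
  have hs' : σ (true, j + 1) = (true, j) := by rw [← hj, h1]
  have hx := h1 (true, j + 2)
  have hx2 := h2 (true, j + 2)
  have hB' : ¬ (σ (true, j + 2)).2 < j + 2 := by rw [H2]; simp [hB]
  refine ⟨⟨fun i => ?_, fun i => ?_⟩, by simp [hs']⟩
  · rw [← H1]
    unfold KOp
    rw [hs']
    rcases hσx : σ (true, j + 2) with ⟨s, k⟩
    rw [hσx] at hx hx2 hB'
    simp only at hB'
    by_cases hik : ((false, i) : Bool × ℕ) = (s, k)
    · rw [hik]; cases s <;> grind
    · simp [hik]
  · have H2i := H2 i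
    unfold KOp
    rw [hs']
    rcases hσx : σ (true, j + 2) with ⟨s, k⟩
    rw [hσx] at hx hx2 hB'
    simp only at hB'
    by_cases hia : i = j + 1
    · subst hia
      simp [hB0]
    · by_cases hia' : i = j + 2
      · subst hia'; simp
      · by_cases hij : i = j
        · subst hij
          rw [hj] at H2i
          simp at H2i
          simp [H2i]; omega
        · by_cases hik : ((true, i) : Bool × ℕ) = (s, k)
          · rw [hik]; cases s <;> grind
          · simp only [hia, false_or] at H2i
            simp [hia, hik, hia', hij, H2i]

/-- States: number of loops together with a matching. -/
abbrev KState : Type := ℕ × {σ : Bool × ℕ → Bool × ℕ // KMatch σ}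

theorem KState_ne (i : ℕ) : ((true, i) : Bool × ℕ) ≠ (true, i + 1) := by simp

def KFunH (i : ℕ) (s : KState) : KState :=
  (s.1 + KLoop s.2.1 (true, i) (true, i + 1),
    ⟨KOp s.2.1 (true, i) (true, i + 1), KOp_match s.2.2 (KState_ne i)⟩)

theorem KFunH_fst (i : ℕ) (s : KState) :
    (KFunH i s).1 = s.1 + KLoop s.2.1 (true, i) (true, i + 1) := rfl

theorem KFunH_snd (i : ℕ) (s : KState) :
    (KFunH i s).2.1 = KOp s.2.1 (true, i) (true, i + 1) := rfl

theorem KLoop_neg {σ : Bool × ℕ → Bool × ℕ} {p q : Bool × ℕ} (h : σ p ≠ q) : KLoop σ p q = 0 :=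
  if_neg h

theorem KState_ext {s t : KState} (h1 : s.1 = t.1) (h2 : s.2.1 = t.2.1) : s = t :=
  Prod.ext h1 (Subtype.ext h2)

def KActH (i : ℕ) : Function.End KState := KFunH i

def KActC : Function.End KState := fun s => (s.1 + 1, s.2)

theorem KActH_commc (i : ℕ) : KActC * KActH i = KActH i * KActC := by
  funext s
  exact KState_ext (Nat.add_right_comm _ _ _) rfl

theorem KActH_sq (i : ℕ) : KActH i * KActH i = KActC * KActH i := by
  funext s
  change KFunH i (KFunH i s) = ((KFunH i s).1 + 1, (KFunH i s).2)
  apply KState_ext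
  · rw [KFunH_fst, KFunH_snd, KLoop, if_pos (by simp [KOp])]
  · rw [KFunH_snd, KFunH_snd]; exact KOp_sq s.2.2 (KState_ne i)

theorem KActH_comm (i j : ℕ) (h : i + 2 ≤ j ∨ j + 2 ≤ i) :
    KActH i * KActH j = KActH j * KActH i := by
  funext s
  change KFunH i (KFunH j s) = KFunH j (KFunH i s)
  apply KState_ext
  · simp only [KFunH_fst, KFunH_snd]
    rw [add_assoc, add_assoc, KOp_comm_count s.2.2] <;> simp <;> omega
  · simp only [KFunH_snd]; apply KOp_comm s.2.2 <;> simp <;> omega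

theorem KActH_braid (i j : ℕ) (h : i + 1 = j ∨ j + 1 = i) :
    KActH i * KActH j * KActH i = KActH i := by
  funext s
  change KFunH i (KFunH j (KFunH i s)) = KFunH i s
  have hm := s.2.2
  rcases h with rfl | rfl
  · obtain ⟨h1, h2⟩ := KOp_braid_count hm (p := (true, i)) (q := (true, i + 1))
      (r := (true, i + 1 + 1)) (by simp) (by simp) (by simp; omega)
    apply KState_ext
    · simp only [KFunH_fst, KFunH_snd, KLoop_neg h1, KLoop_neg h2, add_zero]
    · simp only [KFunH_snd]; apply KOp_braid hm <;> simp; omega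
  · obtain ⟨h1, h2⟩ := KOp_braid_count hm (p := (true, j + 1 + 1)) (q := (true, j + 1))
      (r := (true, j)) (by simp) (by simp) (by simp; omega)
    have h3 := KOp_braid hm (p := (true, j + 1 + 1)) (q := (true, j + 1))
      (r := (true, j)) (by simp) (by simp) (by simp; omega)
    have m1 := KOp_match hm (p := (true, j + 1 + 1)) (q := (true, j + 1)) (by simp)
    have m2 := KOp_match m1 (p := (true, j + 1)) (q := (true, j)) (by simp)
    have e1 := KOp_symm hm (p := (true, j + 1 + 1)) (q := (true, j + 1)) (by simp)
    have e2 := KOp_symm m1 (p := (true, j + 1)) (q := (true, j)) (by simp)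
    have e3 := KOp_symm m2 (p := (true, j + 1 + 1)) (q := (true, j + 1)) (by simp)
    rw [e3] at h3
    rw [e2] at h3 h2 m2
    rw [e1] at h3 h2 m2 h1 m1
    apply KState_ext
    · have h1' : KOp s.2.1 (true, j + 1) (true, j + 1 + 1) (true, j) ≠ (true, j + 1) := by
        intro h; apply h1; have := m1.1 (true, j); rwa [h] at this
      have h2' : KOp (KOp s.2.1 (true, j + 1) (true, j + 1 + 1)) (true, j) (true, j + 1)
          (true, j + 1) ≠ (true, j + 1 + 1) := by
        intro h; apply h2; have := m2.1 (true, j + 1); rwa [h] at this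
      simp only [KFunH_fst, KFunH_snd, KLoop_neg h1', KLoop_neg h2', add_zero]
    · simp only [KFunH_snd]; exact h3

theorem KActD_inv (s : KState) {A B : ℕ → Prop} (H : KInv s.2.1 A B) (a d : ℕ)
    (hA : ∀ i ≤ a, ¬ A i) (hB : ∀ i ≤ a + d + 1, ¬ B i) :
    (KD KActH a (d + 1) s).1 = s.1 ∧
    (KD KActH a (d + 1) s).2.1 (true, a + d) = (true, a + d + 1) ∧
    KInv (KD KActH a (d + 1) s).2.1 (fun i => i = a ∨ A i) (fun i => i = a + d + 1 ∨ B i) := by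
  induction d with
  | zero =>
    obtain ⟨h1, h2⟩ := H.first s.2.2 hA (hB _ (by omega))
    rw [KD_one]
    refine ⟨?_, ?_, h1⟩
    · change (KFunH a s).1 = s.1
      rw [KFunH_fst, KLoop_neg h2, add_zero]
    · simp [KActH, KFunH, KOp]
  | succ d ih =>
    obtain ⟨i1, i2, i3⟩ := ih (fun i hi => hB i (by omega))
    rw [KD]
    change (KActH (a + (d + 1)) (KD KActH a (d + 1) s)).1 = _ ∧
      (KActH (a + (d + 1)) (KD KActH a (d + 1) s)).2.1 _ = _ ∧
      KInv (KActH (a + (d + 1)) (KD KActH a (d + 1) s)).2.1 _ _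
    generalize KD KActH a (d + 1) s = s' at *
    obtain ⟨h1, h2⟩ := i3.next s'.2.2 i2 (hB _ (by omega)) (hB _ (by omega))
    refine ⟨?_, ?_, h1⟩
    · rw [← i1]
      change (KFunH _ s').1 = _
      rw [KFunH_fst]; exact congrArg _ (KLoop_neg h2)
    · change (KFunH _ s').2.1 _ = _
      rw [KFunH_snd]; simp [KOp, add_assoc]

/-- The initial state: the identity diagram. -/
def KState0 : KState := (0, ⟨fun x => (!x.1, x.2), by
  constructor
  · intro x; simp
  · rintro ⟨s, k⟩; simp⟩)

theorem KActC_pow (l : ℕ) (s : KState) : (KActC ^ l) s = (s.1 + l, s.2) := by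
  induction l with
  | zero => rfl
  | succ l ih =>
    rw [pow_succ']
    change KActC ((KActC ^ l) s) = _
    rw [ih]; rfl

theorem KAct_list (L : List (ℕ × ℕ)) (hp : L.Pairwise fun p q => p.1 < q.1 ∧ p.2 < q.2)
    (hle : ∀ p ∈ L, p.1 ≤ p.2) :
    ((L.map fun p => KD KActH p.1 (p.2 + 1 - p.1)).prod KState0).1 = 0 ∧
    KInv ((L.map fun p => KD KActH p.1 (p.2 + 1 - p.1)).prod KState0).2.1
      (fun i => i ∈ L.map Prod.fst) (fun i => i ∈ L.map (fun p => p.2 + 1)) := by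
  induction L with
  | nil =>
    refine ⟨rfl, fun i => ?_, fun i => ?_⟩ <;> simp [KState0, Function.End.one_def]
  | cons p L ih =>
    rw [List.pairwise_cons] at hp
    obtain ⟨i1, i2⟩ := ih hp.2 (fun q hq => hle q (List.mem_cons_of_mem _ hq))
    obtain ⟨a, b⟩ := p
    have hab := hle (a, b) (List.mem_cons_self)
    obtain ⟨d, rfl⟩ : ∃ d, b = a + d := ⟨b - a, by simp at hab; omega⟩
    rw [List.map_cons, List.prod_cons]
    simp only [show a + d + 1 - a = d + 1 by omega]
    have := KActD_inv _ i2 a d (by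
        intro i hi hm
        obtain ⟨q, hq, rfl⟩ := List.mem_map.1 hm
        have := (hp.1 q hq).1
        simp at this; omega) (by
        intro i hi hm
        obtain ⟨q, hq, rfl⟩ := List.mem_map.1 hm
        have := (hp.1 q hq).2
        simp at this; omega)
    exact ⟨this.1.trans i1, fun i => (this.2.2.1 i).trans (by simp),
      fun i => (this.2.2.2 i).trans (by simp)⟩

theorem KAct_inj (l l' : ℕ) (L L' : List (ℕ × ℕ))
    (hp : L.Pairwise fun p q => p.1 < q.1 ∧ p.2 < q.2) (hle : ∀ p ∈ L, p.1 ≤ p.2)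
    (hp' : L'.Pairwise fun p q => p.1 < q.1 ∧ p.2 < q.2) (hle' : ∀ p ∈ L', p.1 ≤ p.2)
    (h : KActC ^ l * (L.map fun p => KD KActH p.1 (p.2 + 1 - p.1)).prod =
      KActC ^ l' * (L'.map fun p => KD KActH p.1 (p.2 + 1 - p.1)).prod) : l = l' ∧ L = L' := by
  have h0 := congrFun h KState0
  simp only [Function.End.mul_def, Function.comp, KActC_pow] at h0
  obtain ⟨i1, i2, i3⟩ := KAct_list L hp hle
  obtain ⟨j1, j2, j3⟩ := KAct_list L' hp' hle'
  rw [i1, j1] at h0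
  rw [Prod.mk.injEq] at h0
  obtain ⟨h1, h2⟩ := h0
  refine ⟨by omega, ?_⟩
  rw [h2] at i2 i3
  have e1 : L.map Prod.fst = L'.map Prod.fst := by
    apply List.Pairwise.eq_of_mem_iff (r := (· < ·))
    · rw [List.pairwise_map]; exact hp.imp fun h => h.1
    · rw [List.pairwise_map]; exact hp'.imp fun h => h.1
    · intro i; exact (i2 i).symm.trans (j2 i)
  have e2 : L.map (fun p => p.2 + 1) = L'.map (fun p => p.2 + 1) := by
    apply List.Pairwise.eq_of_mem_iff (r := (· < ·))
    · rw [List.pairwise_map]; exact hp.imp fun h => by simpa using h.2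
    · rw [List.pairwise_map]; exact hp'.imp fun h => by simpa using h.2
    · intro i; exact (i3 i).symm.trans (j3 i)
  have hinj : Function.Injective fun p : ℕ × ℕ => (p.1, p.2 + 1) := by
    rintro ⟨a, b⟩ ⟨a', b'⟩ h; simpa using h
  apply List.map_injective_iff.2 hinj
  have : ∀ L : List (ℕ × ℕ), L.map (fun p => (p.1, p.2 + 1)) =
      (L.map Prod.fst).zip (L.map fun p => p.2 + 1) := by
    intro L; rw [List.zip_map']
  rw [this, this, e1, e2]

theorem KD_range {M : Type} [Monoid M] (g : ℕ → M) (b d : ℕ) (hd : d ≤ b + 1) :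
    ((List.range d).map fun t => g (b - t)).prod = KD g (b + 1 - d) d := by
  induction d with
  | zero => simp [KD]
  | succ d ih =>
    rw [List.range_succ, List.map_append, List.prod_append, ih (by omega), KD_succ',
      show b + 1 - (d + 1) + 1 = b + 1 - d by omega, show b + 1 - (d + 1) = b - d by omega]
    simp

theorem KD_hInterval {M : Type} [Monoid M] (n : ℕ) (g : ℕ → M) (ψ : FreeMonoid (KGen n) →* M)
    (hψ : ∀ i : Fin (n - 1), ψ (hgen n i) = g i) (a b : Fin (n - 1)) :
    ψ (hInterval n a b) = KD g a (b + 1 - a) := by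
  unfold hInterval
  rw [map_list_prod, List.map_map]
  have : (ψ ∘ fun t => FreeMonoid.of (some
      (⟨b.val - t, Nat.lt_of_le_of_lt (Nat.sub_le _ _) b.isLt⟩ : Fin (n - 1)))) =
      fun t => g (b.val - t) := by
    funext t
    exact hψ _
  rw [this, KD_range g _ _ (by omega)]
  by_cases h : a.val ≤ b.val
  · rw [show b.val + 1 - (b.val + 1 - a.val) = a.val by omega]
  · rw [show b.val + 1 - a.val = 0 by omega]; rfl

theorem KD_word {M : Type} [Monoid M] (n : ℕ) (c : M) (g : ℕ → M) (ψ : FreeMonoid (KGen n) →* M)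
    (hc : ψ (cgen n) = c) (hψ : ∀ i : Fin (n - 1), ψ (hgen n i) = g i) (l k : ℕ)
    (a b : Fin k → Fin (n - 1)) :
    ψ (cgen n ^ l * (List.ofFn fun i => hInterval n (a i) (b i)).prod) =
      c ^ l * ((List.ofFn fun i => ((a i : ℕ), (b i : ℕ))).map
        fun p => KD g p.1 (p.2 + 1 - p.1)).prod := by
  rw [map_mul, map_pow, hc, map_list_prod, List.map_ofFn, List.map_ofFn]
  congr 3
  funext i
  exact KD_hInterval n g ψ hψ _ _

def KAct (n : ℕ) : FreeMonoid (KGen n) →* Function.End KState :=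
  FreeMonoid.lift fun x => match x with
    | none => KActC
    | some i => KActH i

theorem KAct_c (n : ℕ) : KAct n (cgen n) = KActC := by simp [KAct, cgen]

theorem KAct_h (n : ℕ) (i : Fin (n - 1)) : KAct n (hgen n i) = KActH i := by simp [KAct, hgen]

theorem KCon_le (n : ℕ) : KCon n ≤ Con.ker (KAct n) := by
  apply Con.conGen_le.2
  intro x y h
  rw [Con.ker_rel]
  cases h with
  | comm i j h => simp only [map_mul, KAct_h]; exact KActH_comm _ _ h
  | braid i j h => simp only [map_mul, KAct_h]; exact KActH_braid _ _ h
  | sq i => simp only [map_mul, KAct_h, KAct_c]; exact KActH_sq _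
  | commc i => simp only [map_mul, KAct_h, KAct_c]; exact KActH_commc _

theorem KAct_eq (n : ℕ) {v w : FreeMonoid (KGen n)}
    (h : ((KCon n).mk' v : K n) = (KCon n).mk' w) : KAct n v = KAct n w :=
  KCon_le n ((Con.eq (KCon n)).1 h)

def KMk (n : ℕ) : FreeMonoid (KGen n) →* K n := (KCon n).mk'

theorem KMk_rel (n : ℕ) {v w : FreeMonoid (KGen n)} (h : KRel n v w) : KMk n v = KMk n w :=
  (Con.eq (KCon n)).2 (ConGen.Rel.of _ _ h)

def KH (n : ℕ) (i : ℕ) : K n := if hi : i < n - 1 then KMk n (hgen n ⟨i, hi⟩) else 1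

theorem KH_eq (n : ℕ) (i : Fin (n - 1)) : KMk n (hgen n i) = KH n i := by simp [KH]

theorem KH_lt {n i : ℕ} (hi : i < n - 1) : KH n i = KMk n (hgen n ⟨i, hi⟩) := by simp [KH, hi]

theorem KMk_surj (n : ℕ) : Function.Surjective (KMk n) := Con.mk'_surjective

theorem KHyp_K (n : ℕ) : KHyp (n - 1) (KMk n (cgen n)) (KH n) where
  comm i j h hj := by
    rw [KH_lt (show i < n - 1 by omega), KH_lt hj, ← map_mul, ← map_mul]
    exact KMk_rel n (KRel.comm _ _ (Or.inl h))
  braid1 i h := by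
    rw [KH_lt (show i < n - 1 by omega), KH_lt h, ← map_mul, ← map_mul]
    exact KMk_rel n (KRel.braid _ _ (Or.inl rfl))
  braid2 i h := by
    rw [KH_lt (show i < n - 1 by omega), KH_lt h, ← map_mul, ← map_mul]
    exact KMk_rel n (KRel.braid _ _ (Or.inr rfl))
  sq i h := by
    rw [KH_lt h, ← map_mul, ← map_mul]
    exact KMk_rel n (KRel.sq _)
  cen x := by
    obtain ⟨w, rfl⟩ := KMk_surj n x
    induction w using FreeMonoid.inductionOn' with
    | one => simp
    | of_mul x xs ih =>
      have h1 : KMk n (cgen n) * KMk n (FreeMonoid.of x) =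
          KMk n (FreeMonoid.of x) * KMk n (cgen n) := by
        cases x with
        | none => rfl
        | some i => rw [← map_mul, ← map_mul]; exact KMk_rel n (KRel.commc i)
      rw [map_mul, ← mul_assoc, h1, mul_assoc, ih, mul_assoc]

theorem KW_all (n : ℕ) (w : FreeMonoid (KGen n)) : ∀ x : K n,
    (∃ N, KW (KMk n (cgen n)) (KH n) (n - 1) N x) →
    ∃ N, KW (KMk n (cgen n)) (KH n) (n - 1) N (x * KMk n w) := by
  induction w using FreeMonoid.inductionOn' with
  | one => intro x hx; simpa using hx
  | of_mul y ys ih =>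
    rintro x ⟨N, hx⟩
    rw [map_mul, ← mul_assoc]
    apply ih
    cases y with
    | none => exact ⟨N, by rw [← cgen, ← (KHyp_K n).cen]; exact hx.cmul⟩
    | some i => exact ⟨N + 1, by rw [← hgen, KH_eq]; exact KW.step _ _ _ hx i.2⟩

theorem KNF_word (n : ℕ) {p q N : ℕ} {x : K n} (hx : KNF (KMk n (cgen n)) (KH n) p q N x) :
    p ≤ n - 1 → ∃ (l k : ℕ) (a b : Fin k → Fin (n - 1)),
    StrictMono a ∧ StrictMono b ∧ (∀ i, a i ≤ b i) ∧ (∀ i, (a i : ℕ) < q) ∧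
      (∀ i, (b i : ℕ) < p) ∧
      x = KMk n (cgen n ^ l * (List.ofFn fun i => hInterval n (a i) (b i)).prod) := by
  induction hx with
  | base p q N l =>
    intro _
    exact ⟨l, 0, Fin.elim0, Fin.elim0, fun i => i.elim0, fun i => i.elim0, fun i => i.elim0,
      fun i => i.elim0, fun i => i.elim0, by simp⟩
  | step p q N N' a0 d x hx h1 h2 h3 ih =>
    intro hp
    obtain ⟨l, k, a, b, ha, hb, hab, haq, hbp, rfl⟩ := ih (by omega)
    refine ⟨l, k + 1, Fin.snoc (α := fun _ => Fin (n - 1)) a ⟨a0, by omega⟩,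
      Fin.snoc (α := fun _ => Fin (n - 1)) b ⟨a0 + d, by omega⟩, ?_, ?_, ?_, ?_, ?_, ?_⟩
    · intro i j
      induction i using Fin.lastCases with
      | last => intro h; exact absurd h (not_lt.2 (Fin.le_last _))
      | cast i =>
        induction j using Fin.lastCases with
        | last => intro _; simp only [Fin.snoc_castSucc, Fin.snoc_last]; exact haq i
        | cast j => intro h; simp only [Fin.snoc_castSucc]; exact ha (by simpa using h)
    · intro i j
      induction i using Fin.lastCases with
      | last => intro h; exact absurd h (not_lt.2 (Fin.le_last _))
      | cast i =>
        induction j using Fin.lastCases with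
        | last => intro _; simp only [Fin.snoc_castSucc, Fin.snoc_last]; exact hbp i
        | cast j => intro h; simp only [Fin.snoc_castSucc]; exact hb (by simpa using h)
    · intro i
      induction i using Fin.lastCases with
      | last => simp only [Fin.snoc_last, Fin.le_def]; omega
      | cast i => simp only [Fin.snoc_castSucc]; exact hab i
    · intro i
      induction i using Fin.lastCases with
      | last => simp only [Fin.snoc_last]; omega
      | cast i => simp only [Fin.snoc_castSucc]; have := haq i; omega
    · intro i
      induction i using Fin.lastCases with
      | last => simp only [Fin.snoc_last]; omega
      | cast i => simp only [Fin.snoc_castSucc]; have := hbp i; omega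
    · rw [List.ofFn_succ']
      simp only [Fin.snoc_castSucc, Fin.snoc_last, List.concat_eq_append, List.prod_append,
        List.prod_singleton]
      rw [← mul_assoc, map_mul _ _ (hInterval n _ _),
        KD_hInterval n (KH n) (KMk n) (KH_eq n)]
      simp only [show a0 + d + 1 - a0 = d + 1 by omega]





/-- **Jones's normal form.** For each `n ≥ 2`, every element of the Kauffman monoid
`K_n` is represented by a unique word in Jones's normal form over the alphabet
`{c, h₁, …, h_{n-1}}`: the map sending each word in Jones's normal form to the element
of `K_n` it represents is a bijection onto `K_n`. -/
theorem jonesNF_bijective (n : ℕ) (hn : 2 ≤ n) :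
    Function.Bijective fun w : {w : FreeMonoid (KGen n) // IsJonesNF n w} =>
      ((KCon n).mk' w.val : K n) := by
  constructor
  · rintro ⟨v, l, k, a, b, ha, hb, hab, rfl⟩ ⟨w, l', k', a', b', ha', hb', hab', rfl⟩ h
    have h1 := KAct_eq n h
    rw [KD_word n _ _ (KAct n) (KAct_c n) (KAct_h n),
      KD_word n _ _ (KAct n) (KAct_c n) (KAct_h n)] at h1
    obtain ⟨rfl, h2⟩ := KAct_inj _ _ _ _
      (List.pairwise_ofFn.2 fun i j hij => ⟨ha hij, hb hij⟩)
      (by intro p hp; obtain ⟨i, rfl⟩ := (List.mem_ofFn' _ _).1 hp; exact hab i)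
      (List.pairwise_ofFn.2 fun i j hij => ⟨ha' hij, hb' hij⟩)
      (by intro p hp; obtain ⟨i, rfl⟩ := (List.mem_ofFn' _ _).1 hp; exact hab' i) h1
    have hk : k = k' := by simpa using congrArg List.length h2
    subst hk
    have h3 := List.ofFn_injective h2
    have h4 : a = a' := by
      funext i; apply Fin.ext; exact congrArg Prod.fst (congrFun h3 i)
    have h5 : b = b' := by
      funext i; apply Fin.ext; exact congrArg Prod.snd (congrFun h3 i)
    subst h4 h5
    rfl
  · intro x
    obtain ⟨w, rfl⟩ := KMk_surj n x
    obtain ⟨N, hN⟩ := KW_all n w 1 ⟨0, by simpa using KW.base (c := KMk n (cgen n)) (h := KH n) 0 0⟩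
    rw [one_mul] at hN
    obtain ⟨l, k, a, b, ha, hb, hab, -, -, h⟩ :=
      KNF_word n ((KHyp_K n).main N _ le_rfl _ hN) le_rfl
    exact ⟨⟨_, l, k, a, b, ha, hb, hab, rfl⟩, h.symm⟩
end
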